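/- Let z = (i/2) · I_{p,q}. For every g ∈ U(p,q), the matrix D(g · z · g⁻¹) belongs to C(p,q); equivalently, Im(Tr(h · D(g · z · g⁻¹) · h⁻¹ · I_{p,q})) ≥ 0 for all g, h ∈ U(p,q). -/

import Mathlib

open Matrix Complex Pointwise

noncomputable def Ipq (p q : ℕ) : Matrix (Fin (p + q)) (Fin (p + q)) ℂ :=
  Matrix.diagonal fun i => if (i : ℕ) < p then 1 else -1

/-- The pseudo-unitary group `U(p,q)` as a set of matrices. -/
def Upq (p q : ℕ) : Set (Matrix (Fin (p + q)) (Fin (p + q)) ℂ) :=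
  {g | IsUnit g ∧ g * Ipq p q * g.conjTranspose = Ipq p q}

/-- The diagonal matrix with entries `i * x_k`. -/
noncomputable def dmat {n : ℕ} (x : Fin n → ℝ) : Matrix (Fin n) (Fin n) ℂ :=
  Matrix.diagonal fun i => Complex.I * (x i : ℂ)

/-- The holomorphic chamber `C_{p,q}`: `x_1 ≥ ⋯ ≥ x_p > x_{p+1} ≥ ⋯ ≥ x_{p+q}`. -/
def Chol (p q : ℕ) : Set (Fin (p + q) → ℝ) :=
  {x | (∀ i j : Fin (p + q), (i : ℕ) ≤ (j : ℕ) → ((j : ℕ) < p ∨ p ≤ (i : ℕ)) → x j ≤ x i) ∧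
       ∀ i j : Fin (p + q), (i : ℕ) < p → p ≤ (j : ℕ) → x j < x i}

/-- The adjoint orbit `O_x = {g d_x g⁻¹ : g ∈ U(p,q)}`. -/
def Orbit (p q : ℕ) (x : Fin (p + q) → ℝ) : Set (Matrix (Fin (p + q)) (Fin (p + q)) ℂ) :=
  {Y | ∃ g ∈ Upq p q, Y = g * dmat x * g⁻¹}

/-- The Lie algebra `𝔲(p,q)`. -/
def upqLie (p q : ℕ) : Set (Matrix (Fin (p + q)) (Fin (p + q)) ℂ) :=
  {X | X * Ipq p q + Ipq p q * X.conjTranspose = 0}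

/-- The invariant cone `C(p,q) ⊆ 𝔲(p,q)`. -/
def Cpq (p q : ℕ) : Set (Matrix (Fin (p + q)) (Fin (p + q)) ℂ) :=
  {X | X ∈ upqLie p q ∧ ∀ g ∈ Upq p q, 0 ≤ ((g * X * g⁻¹ * Ipq p q).trace).im}

/-- The interior of `C(p,q)` relative to the subspace `𝔲(p,q)`. -/
def interiorC (p q : ℕ) : Set (Matrix (Fin (p + q)) (Fin (p + q)) ℂ) :=
  {X | ∃ h : X ∈ upqLie p q,
    (⟨X, h⟩ : upqLie p q) ∈ interior (Subtype.val ⁻¹' Cpq p q)}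

/-- The block-diagonal part `D(X)` of a matrix, keeping the upper-left `p×p`
and lower-right `q×q` blocks. -/
noncomputable def blockDiagPart (p q : ℕ) (X : Matrix (Fin (p + q)) (Fin (p + q)) ℂ) :
    Matrix (Fin (p + q)) (Fin (p + q)) ℂ :=
  fun i j => if ((i : ℕ) < p ↔ (j : ℕ) < p) then X i j else 0

theorem Ipq_mul_self (p q : ℕ) : Ipq p q * Ipq p q = 1 := by
  rw [Ipq, diagonal_mul_diagonal, ← diagonal_one]
  congr 1
  ext i
  split_ifs <;> simp

theorem Ipq_mul_Ipq_mul (p q : ℕ) (A : Matrix (Fin (p + q)) (Fin (p + q)) ℂ) :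
    Ipq p q * (Ipq p q * A) = A := by
  rw [← Matrix.mul_assoc, Ipq_mul_self, Matrix.one_mul]

theorem conjTranspose_Ipq (p q : ℕ) : (Ipq p q)ᴴ = Ipq p q := by
  rw [Ipq, diagonal_conjTranspose]
  congr 1
  ext i
  simp only [Pi.star_apply]
  split_ifs <;> simp

theorem inv_eq_of_mem_Upq {p q : ℕ} {g : Matrix (Fin (p + q)) (Fin (p + q)) ℂ}
    (hg : g ∈ Upq p q) : g⁻¹ = Ipq p q * gᴴ * Ipq p q := by
  apply inv_eq_right_inv
  rw [← Matrix.mul_assoc, ← Matrix.mul_assoc, hg.2, Ipq_mul_self]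

theorem blockDiagPart_eq (p q : ℕ) (X : Matrix (Fin (p + q)) (Fin (p + q)) ℂ) :
    blockDiagPart p q X = (1 / 2 : ℂ) • (X + Ipq p q * X * Ipq p q) := by
  ext i j
  simp only [blockDiagPart, Ipq, Matrix.smul_apply, Matrix.add_apply, mul_diagonal,
    diagonal_mul, smul_eq_mul]
  by_cases hi : (i : ℕ) < p <;> by_cases hj : (j : ℕ) < p <;> simp [hi, hj] <;> ring

/-- With `J = I_{p,q}`, the block-diagonal part of `g z g⁻¹` is `(i/4) (g gᴴ + J g gᴴ J) J`. -/
theorem blockDiagPart_conj_eq {p q : ℕ} {g : Matrix (Fin (p + q)) (Fin (p + q)) ℂ}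
    (hg : g ∈ Upq p q) :
    blockDiagPart p q (g * ((Complex.I / 2) • Ipq p q) * g⁻¹) =
      (Complex.I / 4) • ((g * gᴴ + (Ipq p q * g) * (Ipq p q * g)ᴴ) * Ipq p q) := by
  rw [blockDiagPart_eq, inv_eq_of_mem_Upq hg, conjTranspose_mul, conjTranspose_Ipq]
  simp only [Matrix.mul_assoc, Matrix.smul_mul, Matrix.mul_smul, Ipq_mul_Ipq_mul, ← smul_add,
    smul_smul, Matrix.add_mul]
  congr 1
  ring

open scoped ComplexOrder in
theorem trace_mul_conjTranspose_re_nonneg {n : ℕ} (A : Matrix (Fin n) (Fin n) ℂ) :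
    0 ≤ (A * Aᴴ).trace.re :=
  (Complex.le_def.mp (posSemidef_self_mul_conjTranspose A).trace_nonneg).1

theorem statement12 (p q : ℕ) (hq : 1 ≤ q) (hpq : q ≤ p)
    (g : Matrix (Fin (p + q)) (Fin (p + q)) ℂ) (hg : g ∈ Upq p q) :
    blockDiagPart p q (g * ((Complex.I / 2) • Ipq p q) * g⁻¹) ∈ Cpq p q := by
  rw [blockDiagPart_conj_eq hg]
  refine ⟨?_, fun h hh => ?_⟩
  · simp only [upqLie, Set.mem_ofPred_eq, conjTranspose_smul, conjTranspose_mul, conjTranspose_add,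
      conjTranspose_conjTranspose, conjTranspose_Ipq, Matrix.smul_mul, Matrix.mul_smul,
      Matrix.mul_assoc, Ipq_mul_Ipq_mul, Ipq_mul_self, Matrix.mul_one]
    rw [← add_smul]
    simp [neg_div]
  · have key : h * ((Complex.I / 4) • ((g * gᴴ + (Ipq p q * g) * (Ipq p q * g)ᴴ) * Ipq p q)) *
        h⁻¹ * Ipq p q = (Complex.I / 4) • ((h * g) * (h * g)ᴴ +
          (h * (Ipq p q * g)) * (h * (Ipq p q * g))ᴴ) := by
      rw [inv_eq_of_mem_Upq hh]
      simp only [conjTranspose_mul, Matrix.smul_mul, Matrix.mul_smul, Matrix.mul_assoc,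
        Ipq_mul_Ipq_mul, Ipq_mul_self, Matrix.mul_one, Matrix.mul_add, Matrix.add_mul]
    have h₁ := trace_mul_conjTranspose_re_nonneg (h * g)
    have h₂ := trace_mul_conjTranspose_re_nonneg (h * (Ipq p q * g))
    have him : ∀ w : ℂ, (Complex.I / 4 * w).im = w.re / 4 := fun w => by
      rw [div_mul_eq_mul_div, Complex.div_ofNat_im, Complex.I_mul_im]
    rw [key, trace_smul, trace_add, smul_eq_mul, him, Complex.add_re]
    positivity
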